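/- arXiv:1105.0185 — 2 statements merged into one kernel-verified Lean document; each statement's English description precedes it below -/
import Mathlib

section
/- Let W₉ := {A ∈ K₊ : A(x,y,z,w) = -A(x,y,w,z) for all x,y,z,w} ∩ ker(ρ) and W₁₀ := {A ∈ K₊ : A(x,y,z,w) = A(x,y,w,z) for all x,y,z,w} ∩ ker(ρ). The conjugation T, defined on 4-tensors by (TA)(x,y,z,w) := A(x,y,z,Jw), maps W₉ into W₁₀ and maps W₁₀ into W₉; since T ∘ T = -id, T restricts to linear bijections W₉ → W₁₀ and W₁₀ → W₉. -/
open Module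
open scoped RealInnerProductSpace

variable {V : Type*} [NormedAddCommGroup V] [InnerProductSpace ℝ V] [FiniteDimensional ℝ V]

/-- `A` is an affine curvature operator. -/
def IsAff (A : V →ₗ[ℝ] V →ₗ[ℝ] V →ₗ[ℝ] V) : Prop :=
  (∀ x y, A x y = - A y x) ∧ ∀ x y z, A x y z + A y z x + A z x y = 0

/-- The Ricci tensor `ρ(A)(x,y) = Tr (z ↦ A(z,x)y)`. -/
noncomputable def rho (A : V →ₗ[ℝ] V →ₗ[ℝ] V →ₗ[ℝ] V) (x y : V) : ℝ :=
  LinearMap.trace ℝ V ((A.flip x).flip y)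

/-- `A` is an affine Kähler curvature operator: `A ∈ 𝔄` and `A(x,y)` commutes with `J`. -/
def IsK (J : V →ₗ[ℝ] V) (A : V →ₗ[ℝ] V →ₗ[ℝ] V →ₗ[ℝ] V) : Prop :=
  IsAff A ∧ ∀ x y z, A x y (J z) = J (A x y z)

/-- `A ∈ K₊`. -/
def IsKplus (J : V →ₗ[ℝ] V) (A : V →ₗ[ℝ] V →ₗ[ℝ] V →ₗ[ℝ] V) : Prop :=
  IsK J A ∧ ∀ x y, A (J x) (J y) = A x y

/-- `A ∈ W₉ = {A ∈ K₊ : A(x,y,z,w) = -A(x,y,w,z)} ∩ ker ρ`, where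
`A(x,y,z,w) = ⟨A(x,y)z, w⟩`. -/
def MemW9 (J : V →ₗ[ℝ] V) (A : V →ₗ[ℝ] V →ₗ[ℝ] V →ₗ[ℝ] V) : Prop :=
  IsKplus J A ∧ (∀ x y z w : V, ⟪A x y z, w⟫ = - ⟪A x y w, z⟫) ∧ ∀ x y, rho A x y = 0

/-- `A ∈ W₁₀ = {A ∈ K₊ : A(x,y,z,w) = A(x,y,w,z)} ∩ ker ρ`. -/
def MemW10 (J : V →ₗ[ℝ] V) (A : V →ₗ[ℝ] V →ₗ[ℝ] V →ₗ[ℝ] V) : Prop :=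
  IsKplus J A ∧ (∀ x y z w : V, ⟪A x y z, w⟫ = ⟪A x y w, z⟫) ∧ ∀ x y, rho A x y = 0

theorem Kplus_aux (J : V →ₗ[ℝ] V) (A B : V →ₗ[ℝ] V →ₗ[ℝ] V →ₗ[ℝ] V) (s : ℝ)
    (h : ∀ x y z, B x y z = s • J (A x y z)) (hA : IsKplus J A)
    (hr : ∀ x y, rho A x y = 0) : IsKplus J B ∧ ∀ x y, rho B x y = 0 := by
  obtain ⟨⟨⟨h1, h2⟩, h3⟩, h4⟩ := hA
  refine ⟨⟨⟨⟨?_, ?_⟩, ?_⟩, ?_⟩, ?_⟩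
  · intro x y
    ext z
    rw [LinearMap.neg_apply, h, h, h1 x y]
    simp
  · intro x y z
    rw [h, h, h, ← smul_add, ← smul_add, ← map_add, ← map_add, h2]
    simp
  · intro x y z
    rw [h, h, h3, map_smul]
  · intro x y
    ext z
    rw [h, h, h4]
  · intro x y
    have e : (B.flip x).flip y = s • ((A.flip x).flip (J y)) := by
      ext z
      simp [h, h3]
    have := hr x (J y)
    unfold rho at this ⊢
    rw [e, map_smul, this, smul_zero]

theorem J_skew (J : V →ₗ[ℝ] V) (hJ : ∀ v, J (J v) = -v)
    (hJinner : ∀ x y : V, ⟪J x, J y⟫ = ⟪x, y⟫) (x y : V) : ⟪J x, y⟫ = - ⟪x, J y⟫ := by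
  rw [← hJinner x (J y), hJ, inner_neg_right, neg_neg]

theorem W9_to_W10 (J : V →ₗ[ℝ] V) (hJ : ∀ v, J (J v) = -v)
    (hJinner : ∀ x y : V, ⟪J x, J y⟫ = ⟪x, y⟫)
    (A B : V →ₗ[ℝ] V →ₗ[ℝ] V →ₗ[ℝ] V) (s : ℝ)
    (h : ∀ x y z, B x y z = s • J (A x y z)) (hA : MemW9 J A) : MemW10 J B := by
  obtain ⟨hk, hs, hr⟩ := hA
  obtain ⟨a, b⟩ := Kplus_aux J A B s h hk hr
  refine ⟨a, ?_, b⟩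
  intro x y z w
  rw [h, h, ← hk.1.2, real_inner_smul_left, real_inner_smul_left, hs,
    J_skew J hJ hJinner]

theorem W10_to_W9 (J : V →ₗ[ℝ] V) (hJ : ∀ v, J (J v) = -v)
    (hJinner : ∀ x y : V, ⟪J x, J y⟫ = ⟪x, y⟫)
    (A B : V →ₗ[ℝ] V →ₗ[ℝ] V →ₗ[ℝ] V) (s : ℝ)
    (h : ∀ x y z, B x y z = s • J (A x y z)) (hA : MemW10 J A) : MemW9 J B := by
  obtain ⟨hk, hs, hr⟩ := hA
  obtain ⟨a, b⟩ := Kplus_aux J A B s h hk hr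
  refine ⟨a, ?_, b⟩
  intro x y z w
  rw [h, h, ← hk.1.2, real_inner_smul_left, real_inner_smul_left, hs,
    J_skew J hJ hJinner, mul_neg, neg_neg]

theorem T_eq (J : V →ₗ[ℝ] V) (hJ : ∀ v, J (J v) = -v)
    (hJinner : ∀ x y : V, ⟪J x, J y⟫ = ⟪x, y⟫)
    (A B : V →ₗ[ℝ] V →ₗ[ℝ] V →ₗ[ℝ] V)
    (h : ∀ x y z w : V, ⟪B x y z, w⟫ = ⟪A x y z, J w⟫) :
    ∀ x y z, B x y z = (-1 : ℝ) • J (A x y z) := by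
  intro x y z
  refine ext_inner_right ℝ fun w => ?_
  rw [h, real_inner_smul_left, J_skew J hJ hJinner]
  ring

/-- The operator `J ∘ B`. -/
noncomputable def compJ (J : V →ₗ[ℝ] V) (B : V →ₗ[ℝ] V →ₗ[ℝ] V →ₗ[ℝ] V) :
    V →ₗ[ℝ] V →ₗ[ℝ] V →ₗ[ℝ] V :=
  LinearMap.mk₂ ℝ (fun x y => J ∘ₗ B x y)
    (by intros; ext; simp) (by intros; ext; simp) (by intros; ext; simp) (by intros; ext; simp)

/-- the conjugation `T`, defined on 4-tensors by
`(TA)(x,y,z,w) = A(x,y,z,Jw)`, maps `W₉` into `W₁₀` and `W₁₀` into `W₉`; since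
`T ∘ T = -id`, it restricts to linear bijections `W₉ → W₁₀` and `W₁₀ → W₉`. -/
theorem statement18 (J : V →ₗ[ℝ] V) (hJ : ∀ v, J (J v) = -v)
    (hJinner : ∀ x y : V, ⟪J x, J y⟫ = ⟪x, y⟫) :
    (∀ A B : V →ₗ[ℝ] V →ₗ[ℝ] V →ₗ[ℝ] V, MemW9 J A →
      (∀ x y z w : V, ⟪B x y z, w⟫ = ⟪A x y z, J w⟫) → MemW10 J B) ∧
    (∀ A B : V →ₗ[ℝ] V →ₗ[ℝ] V →ₗ[ℝ] V, MemW10 J A →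
      (∀ x y z w : V, ⟪B x y z, w⟫ = ⟪A x y z, J w⟫) → MemW9 J B) ∧
    (∀ A B : V →ₗ[ℝ] V →ₗ[ℝ] V →ₗ[ℝ] V,
      (∀ x y z w : V, ⟪B x y z, w⟫ = ⟪A x y z, J w⟫) →
      ∀ x y z w : V, ⟪B x y z, J w⟫ = - ⟪A x y z, w⟫) ∧
    (∀ B : V →ₗ[ℝ] V →ₗ[ℝ] V →ₗ[ℝ] V, MemW10 J B →
      ∃ A : V →ₗ[ℝ] V →ₗ[ℝ] V →ₗ[ℝ] V, MemW9 J A ∧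
        ∀ x y z w : V, ⟪B x y z, w⟫ = ⟪A x y z, J w⟫) ∧
    (∀ B : V →ₗ[ℝ] V →ₗ[ℝ] V →ₗ[ℝ] V, MemW9 J B →
      ∃ A : V →ₗ[ℝ] V →ₗ[ℝ] V →ₗ[ℝ] V, MemW10 J A ∧
        ∀ x y z w : V, ⟪B x y z, w⟫ = ⟪A x y z, J w⟫) := by
  refine ⟨fun A B hA h => W9_to_W10 J hJ hJinner A B (-1) (T_eq J hJ hJinner A B h) hA,
    fun A B hA h => W10_to_W9 J hJ hJinner A B (-1) (T_eq J hJ hJinner A B h) hA,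
    fun A B h x y z w => by rw [h, hJ, inner_neg_right],
    fun B hB => ⟨compJ J B, W10_to_W9 J hJ hJinner B _ 1 (fun x y z => by simp [compJ]) hB,
      fun x y z w => by simp [compJ, hJinner]⟩,
    fun B hB => ⟨compJ J B, W9_to_W10 J hJ hJinner B _ 1 (fun x y z => by simp [compJ]) hB,
      fun x y z w => by simp [compJ, hJinner]⟩⟩
end

section
/- Let A ∈ K₊ with ρ(A) = 0 and with ρ₁₃(A) ∈ Λ²₀₊ (ρ₁₃(A) is alternating, satisfies ρ₁₃(A)(Jx,Jy) = ρ₁₃(A)(x,y), and Σᵢ ρ₁₃(A)(eᵢ,Jeᵢ) = 0). Define the 4-tensor B(x,y,z,w) := (1/4)·(A(x,y,z,w) + A(y,x,w,z) + A(z,w,x,y) + A(w,z,y,x)). Then the operator corresponding to B lies in K₊ (B(x,y,z,w) = -B(y,x,z,w), B satisfies the Bianchi identity B(x,y,z,w) + B(y,z,x,w) + B(z,x,y,w) = 0, B(x,y,Jz,Jw) = B(x,y,z,w), and B(Jx,Jy,z,w) = B(x,y,z,w)) and satisfies ρ(B) = 0. -/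
open Module
open scoped RealInnerProductSpace

variable {V : Type*} [NormedAddCommGroup V] [InnerProductSpace ℝ V] [FiniteDimensional ℝ V]

/-- for `A ∈ K₊ ∩ ker ρ` with `ρ₁₃(A) ∈ Λ²₀₊`, the symmetrized 4-tensor
`B(x,y,z,w) = (1/4)(A(x,y,z,w) + A(y,x,w,z) + A(z,w,x,y) + A(w,z,y,x))` defines an
operator in `K₊` with `ρ(B) = 0`, where `A(x,y,z,w) = ⟨A(x,y)z, w⟩`. -/
theorem statement19 {m : ℕ} (e : OrthonormalBasis (Fin m) ℝ V)
    (J : V →ₗ[ℝ] V) (hJ : ∀ v, J (J v) = -v)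
    (hJinner : ∀ x y : V, ⟪J x, J y⟫ = ⟪x, y⟫)
    (A : V →ₗ[ℝ] V →ₗ[ℝ] V →ₗ[ℝ] V) (hA : IsKplus J A)
    (hρ : ∀ x y, rho A x y = 0)
    (halt : ∀ x y : V, (∑ i, ⟪A (e i) x (e i), y⟫) = - ∑ i, ⟪A (e i) y (e i), x⟫)
    (hJ13 : ∀ x y : V, (∑ i, ⟪A (e i) (J x) (e i), J y⟫) = ∑ i, ⟪A (e i) x (e i), y⟫)
    (htr13 : (∑ j, ∑ i, ⟪A (e i) (e j) (e i), J (e j)⟫) = 0)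
    (B : V → V → V → V → ℝ)
    (hB : ∀ x y z w : V, B x y z w =
      (1 / 4) * (⟪A x y z, w⟫ + ⟪A y x w, z⟫ + ⟪A z w x, y⟫ + ⟪A w z y, x⟫)) :
    (∀ x y z w : V, B x y z w = - B y x z w) ∧
    (∀ x y z w : V, B x y z w + B y z x w + B z x y w = 0) ∧
    (∀ x y z w : V, B x y (J z) (J w) = B x y z w) ∧
    (∀ x y z w : V, B (J x) (J y) z w = B x y z w) ∧
    (∀ x y : V, (∑ i, B (e i) x y (e i)) = 0) := by
  obtain ⟨⟨⟨hs, hb⟩, hK⟩, hP⟩ := hA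
  have s' : ∀ x y z w : V, ⟪A x y z, w⟫ = -⟪A y x z, w⟫ := by
    intro x y z w
    rw [hs x y, LinearMap.neg_apply, inner_neg_left]
  have b' : ∀ x y z w : V, ⟪A x y z, w⟫ + ⟪A y z x, w⟫ + ⟪A z x y, w⟫ = 0 := by
    intro x y z w
    rw [← inner_add_left, ← inner_add_left, hb, inner_zero_left]
  have k' : ∀ x y z w : V, ⟪A x y (J z), J w⟫ = ⟪A x y z, w⟫ := by
    intro x y z w
    rw [hK, hJinner]
  have r' : ∀ x y : V, ∑ i, ⟪A (e i) x y, e i⟫ = 0 := by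
    intro x y
    rw [← hρ x y, rho, LinearMap.trace_eq_sum_inner _ e]
    refine Finset.sum_congr rfl fun i _ => ?_
    rw [real_inner_comm]
    rfl
  refine ⟨?_, ?_, ?_, ?_, ?_⟩
  · intro x y z w
    rw [hB, hB]
    linarith [s' x y z w, s' y x w z, s' z w x y, s' w z y x]
  · intro x y z w
    rw [hB, hB, hB]
    linarith [b' x y z w, b' y x w z, b' z y w x, b' x z w y]
  · intro x y z w
    rw [hB, hB, k', k', hP, hP]
  · intro x y z w
    rw [hB, hB, k', k', hP, hP]
  · intro x y
    have h : ∀ i, B (e i) x y (e i) = (1 / 4) * (⟪A (e i) x y, e i⟫ - ⟪A (e i) x (e i), y⟫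
        - ⟪A (e i) y (e i), x⟫ + ⟪A (e i) y x, e i⟫) := by
      intro i
      rw [hB]
      linarith [s' x (e i) (e i) y, s' y (e i) (e i) x]
    simp only [h]
    rw [← Finset.mul_sum, Finset.sum_add_distrib, Finset.sum_sub_distrib,
      Finset.sum_sub_distrib, r', r', halt x y]
    ring
end
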